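/- arXiv:1310.1988 — 13 statements merged into one kernel-verified Lean document; each statement's English description precedes it below -/
import Mathlib

section
/- For any subgroup H of ℤ^r and any γ ∈ ℤ^r, the intersection (γ + H) ∩ ℕ^r is a union of finitely many sets of the form β + (H ∩ ℕ^r) with β ∈ ℕ^r. -/
/-- The set of points of `ℕ^r` lying in the subgroup `H` of `ℤ^r`. -/
def natPart {r : ℕ} (H : AddSubgroup (Fin r → ℤ)) : Set (Fin r → ℕ) :=
  {n | (fun i => (n i : ℤ)) ∈ H}

/-- For any subgroup `H ⊆ ℤ^r` and any `γ ∈ ℤ^r`, the intersection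
`(γ + H) ∩ ℕ^r` is a union of finitely many sets of the form `β + (H ∩ ℕ^r)`
with `β ∈ ℕ^r`. -/
theorem coset_inter_nat (r : ℕ) (H : AddSubgroup (Fin r → ℤ)) (γ : Fin r → ℤ) :
    ∃ B : Finset (Fin r → ℕ),
      {n : Fin r → ℕ | (fun i => (n i : ℤ)) - γ ∈ H}
        = ⋃ β ∈ B, (fun s => β + s) '' natPart H := by
  set S : Set (Fin r → ℕ) := {n | (fun i => (n i : ℤ)) - γ ∈ H}
  have hfin : {n | Minimal (· ∈ S) n}.Finite :=
    WellQuasiOrderedLE.finite_of_isAntichain (setOfPred_minimal_antichain (· ∈ S))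
  refine ⟨hfin.toFinset, ?_⟩
  ext n
  simp only [Set.mem_iUnion, Set.Finite.mem_toFinset, Set.mem_ofPred_eq, Set.mem_image,
    exists_prop]
  constructor
  · intro hn
    obtain ⟨β, hle, hβ⟩ := (Set.isPWO_of_wellQuasiOrderedLE S).exists_le_minimal hn
    refine ⟨β, hβ, n - β, ?_, add_tsub_cancel_of_le hle⟩
    have hmem := H.sub_mem hn hβ.prop
    rw [sub_sub_sub_cancel_right] at hmem
    change (fun i => (((n - β) i : ℕ) : ℤ)) ∈ H
    convert hmem using 1
    ext i
    simp [Nat.cast_sub (hle i)]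
  · rintro ⟨β, hβ, s, hs, rfl⟩
    have hmem := H.add_mem hβ.prop hs
    change (fun i => (((β + s) i : ℕ) : ℤ)) - γ ∈ H
    convert hmem using 1
    ext i
    simp only [Pi.add_apply, Pi.sub_apply, Nat.cast_add]
    ring
end

section
/- For any γ₁, γ₂ ∈ ℕ^r and any subgroups H₁, H₂ of ℤ^r, the intersection (γ₁ + (H₁ ∩ ℕ^r)) ∩ (γ₂ + (H₂ ∩ ℕ^r)) is a union of finitely many sets of the form β + (H ∩ ℕ^r) with β ∈ ℕ^r, where H := H₁ ∩ H₂. -/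
theorem mem_add_natPart_iff {r : ℕ} (γ x : Fin r → ℕ) (H : AddSubgroup (Fin r → ℤ)) :
    x ∈ (fun s => γ + s) '' natPart H ↔
      γ ≤ x ∧ (fun i => (x i : ℤ)) - (fun i => (γ i : ℤ)) ∈ H := by
  constructor
  · rintro ⟨s, hs, rfl⟩
    refine ⟨le_self_add, ?_⟩
    change _ ∈ H at hs
    convert hs using 1
    ext i
    simp
  · rintro ⟨hle, hx⟩
    refine ⟨x - γ, ?_, add_tsub_cancel_of_le hle⟩
    change (fun i => (((x - γ) i : ℕ) : ℤ)) ∈ H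
    convert hx using 1
    ext i
    simp [Nat.cast_sub (hle i)]

/-- For `γ₁, γ₂ ∈ ℕ^r` and subgroups `H₁, H₂ ⊆ ℤ^r`, the intersection
`(γ₁ + (H₁ ∩ ℕ^r)) ∩ (γ₂ + (H₂ ∩ ℕ^r))` is a union of finitely many sets
`β + ((H₁ ∩ H₂) ∩ ℕ^r)` with `β ∈ ℕ^r`. -/
theorem inter_cosets (r : ℕ) (γ₁ γ₂ : Fin r → ℕ)
    (H₁ H₂ : AddSubgroup (Fin r → ℤ)) :
    ∃ B : Finset (Fin r → ℕ),
      ((fun s => γ₁ + s) '' natPart H₁) ∩ ((fun s => γ₂ + s) '' natPart H₂)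
        = ⋃ β ∈ B, (fun s => β + s) '' natPart (H₁ ⊓ H₂) := by
  set S := ((fun s => γ₁ + s) '' natPart H₁) ∩ ((fun s => γ₂ + s) '' natPart H₂) with hS
  have hfin : {x | Minimal (· ∈ S) x}.Finite :=
    WellQuasiOrderedLE.finite_of_isAntichain (setOfPred_minimal_antichain _)
  refine ⟨hfin.toFinset, ?_⟩
  ext x
  simp only [Set.mem_iUnion, Set.Finite.mem_toFinset, Set.mem_ofPred_eq, exists_prop]
  constructor
  · intro hx
    obtain ⟨β, hβx, hβ⟩ := exists_minimal_le_of_wellFoundedLT (· ∈ S) x hx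
    refine ⟨β, hβ, ?_⟩
    have hβS : β ∈ S := hβ.prop
    rw [hS, Set.mem_inter_iff, mem_add_natPart_iff, mem_add_natPart_iff] at hx hβS
    rw [mem_add_natPart_iff]
    refine ⟨hβx, AddSubgroup.mem_inf.mpr ⟨?_, ?_⟩⟩
    · simpa using H₁.sub_mem hx.1.2 hβS.1.2
    · simpa using H₂.sub_mem hx.2.2 hβS.2.2
  · rintro ⟨β, hβ, hx⟩
    have hβS : β ∈ S := hβ.prop
    rw [mem_add_natPart_iff, AddSubgroup.mem_inf] at hx
    rw [hS, Set.mem_inter_iff, mem_add_natPart_iff, mem_add_natPart_iff] at hβS ⊢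
    refine ⟨⟨hβS.1.1.trans hx.1, ?_⟩, ⟨hβS.2.1.trans hx.1, ?_⟩⟩
    · simpa using H₁.add_mem hx.2.1 hβS.1.2
    · simpa using H₂.add_mem hx.2.2 hβS.2.2
end

section
/- Let γ ∈ ℕ^r, let H ⊆ ℤ^r be a subgroup, and let N be a positive integer. Suppose L is a subset of γ + (H ∩ ℕ^r) such that for every τ ∈ H ∩ ℕ^r and every β ∈ L one has β + N·τ ∈ L. Then L is a union of finitely many sets of the form δ + ((N·H) ∩ ℕ^r) with δ ∈ ℕ^r, where N·H := {N·h : h ∈ H}. -/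
/-- The subgroup `N·H = {N·h : h ∈ H}` of `ℤ^r`. -/
def smulSubgroup {r : ℕ} (N : ℕ) (H : AddSubgroup (Fin r → ℤ)) :
    AddSubgroup (Fin r → ℤ) :=
  H.map (AddMonoidHom.mk' (fun x => (N : ℤ) • x) fun a b => smul_add (N : ℤ) a b)

/-- The quotient of a finitely generated abelian group by its `N`-th multiples is finite. -/
lemma finite_quotient_range_nsmul {A : Type*} [AddCommGroup A] [Module.Finite ℤ A] {N : ℕ}
    (hN : 0 < N) : Finite (A ⧸ (nsmulAddMonoidHom N : A →+ A).range) := by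
  have hfg : AddGroup.FG A := Module.Finite.iff_addGroup_fg.mp inferInstance
  have : AddGroup.FG (A ⧸ (nsmulAddMonoidHom N : A →+ A).range) :=
    QuotientAddGroup.fg _
  refine AddCommGroup.finite_of_fg_isAddTorsion _ fun x => ?_
  induction x using QuotientAddGroup.induction_on with
  | H a =>
    refine isOfFinAddOrder_iff_nsmul_eq_zero.mpr ⟨N, hN, ?_⟩
    rw [← QuotientAddGroup.mk_nsmul, QuotientAddGroup.eq_zero_iff]
    exact ⟨a, rfl⟩

/-- In a well-quasi-ordered type, a set coloured with finitely many colours has a finite subset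
such that every element dominates a member of the subset of the same colour. -/
lemma exists_finset_le_of_finite_coloring {α Q : Type*} [PartialOrder α] [WellQuasiOrderedLE α]
    [Finite Q] (S : Set α) (c : S → Q) :
    ∃ B : Finset S, ∀ s : S, ∃ t ∈ B, t ≤ s ∧ c t = c s := by
  have hS : WellQuasiOrderedLE S := ⟨fun f => wellQuasiOrdered_le (fun n => (f n : α))⟩
  have hfin (q : Q) : {s : S | Minimal (fun t => c t = q) s}.Finite :=
    WellQuasiOrderedLE.finite_of_isAntichain (setOfPred_minimal_antichain _)
  refine ⟨(Set.finite_iUnion hfin).toFinset, fun s => ?_⟩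
  obtain ⟨t, hts, ht⟩ := exists_minimal_le_of_wellFoundedLT (fun t => c t = c s) s rfl
  exact ⟨t, by simpa using ⟨c s, ht⟩, hts, ht.prop⟩

lemma mem_natPart_smulSubgroup_iff {r N : ℕ} (hN : 0 < N) {H : AddSubgroup (Fin r → ℤ)}
    {s : Fin r → ℕ} : s ∈ natPart (smulSubgroup N H) ↔ ∃ τ ∈ natPart H, s = N • τ := by
  constructor
  · rintro ⟨h, hh, hs⟩
    have hs' (i : Fin r) : (N : ℤ) * h i = s i := congrFun hs i
    have hpos (i : Fin r) : 0 ≤ h i :=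
      nonneg_of_mul_nonneg_right (by rw [hs' i]; positivity) (by exact_mod_cast hN)
    lift h to Fin r → ℕ using hpos
    refine ⟨h, hh, funext fun i => ?_⟩
    have hsi : (s i : ℤ) = N * h i := (hs' i).symm
    exact_mod_cast hsi
  · rintro ⟨τ, hτ, rfl⟩
    exact ⟨_, hτ, funext fun i => by simp⟩

/-- If `L ⊆ γ + (H ∩ ℕ^r)` is closed under adding `N·τ` for every
`τ ∈ H ∩ ℕ^r`, then `L` is a union of finitely many sets of the form
`δ + ((N·H) ∩ ℕ^r)`. -/
theorem closed_under_N_translates (r N : ℕ) (hN : 0 < N) (γ : Fin r → ℕ)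
    (H : AddSubgroup (Fin r → ℤ)) (L : Set (Fin r → ℕ))
    (hL : L ⊆ (fun s => γ + s) '' natPart H)
    (hclosed : ∀ τ ∈ natPart H, ∀ β ∈ L, β + N • τ ∈ L) :
    ∃ B : Finset (Fin r → ℕ),
      L = ⋃ δ ∈ B, (fun s => δ + s) '' natPart (smulSubgroup N H) := by
  have : Module.Finite ℤ H :=
    inferInstanceAs (Module.Finite ℤ (AddSubgroup.toIntSubmodule H))
  have := finite_quotient_range_nsmul (A := H) hN
  let S : Set (Fin r → ℕ) := {s | s ∈ natPart H ∧ γ + s ∈ L}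
  let c (s : S) : H ⧸ (nsmulAddMonoidHom N : H →+ H).range :=
    QuotientAddGroup.mk ⟨fun i => ((s : Fin r → ℕ) i : ℤ), s.2.1⟩
  obtain ⟨B, hB⟩ := exists_finset_le_of_finite_coloring S c
  classical
  refine ⟨B.image fun s : S => γ + s.1, Set.Subset.antisymm ?_ ?_⟩
  · intro β hβ
    obtain ⟨s, hs, rfl⟩ := hL hβ
    obtain ⟨t, htB, hts, hc⟩ := hB ⟨s, hs, hβ⟩
    have hle : (t : Fin r → ℕ) ≤ s := hts
    obtain ⟨k, hk⟩ := QuotientAddGroup.eq.mp hc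
    refine Set.mem_biUnion (Finset.mem_image_of_mem _ htB) ⟨s - t, ⟨k, k.2, ?_⟩, ?_⟩
    · funext i
      have hki := congrFun (congrArg Subtype.val hk) i
      simp at hki
      simp [Nat.cast_sub (hle i)]
      linarith
    · simp only [add_assoc, add_tsub_cancel_of_le hle]
  · refine Set.iUnion₂_subset fun δ hδ => ?_
    obtain ⟨t, -, rfl⟩ := Finset.mem_image.mp hδ
    rintro _ ⟨s, hs, rfl⟩
    obtain ⟨τ, hτ, rfl⟩ := (mem_natPart_smulSubgroup_iff hN).mp hs
    exact hclosed τ hτ _ t.2.2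
end

section
/- Let π₁ : ℕ^r → ℕ be the projection onto the first coordinate and π_{2,…,r} : ℕ^r → ℕ^{r−1} the projection onto the last r − 1 coordinates. Then for every a ∈ ℕ, every γ ∈ ℕ^r, and every subgroup H ⊆ ℤ^r, the set π_{2,…,r}(π₁^{−1}(a) ∩ (γ + (H ∩ ℕ^r))) belongs to the class 𝒞 (as a subset of ℕ^{r−1}). -/
/-- The class `𝒞` of finite unions of sets `γ + (H ∩ ℕ^r)` with `γ ∈ ℕ^r`
and `H` a subgroup of `ℤ^r`. -/
def inC {r : ℕ} (E : Set (Fin r → ℕ)) : Prop :=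
  ∃ (ℓ : ℕ) (γ : Fin ℓ → (Fin r → ℕ)) (H : Fin ℓ → AddSubgroup (Fin r → ℤ)),
    E = ⋃ i, (fun s => γ i + s) '' natPart (H i)

/-- A set `E ⊆ ℕ^r` which above each of its points `x` coincides with `x + natPart K`
belongs to the class `𝒞`: it is the union of the sets `m + natPart K` over its finitely many
minimal elements `m`. -/
theorem inC_of_forall_add_mem_iff {r : ℕ} {E : Set (Fin r → ℕ)} (K : AddSubgroup (Fin r → ℤ))
    (hE : ∀ x ∈ E, ∀ d, x + d ∈ E ↔ d ∈ natPart K) : inC E := by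
  have hfin : {m | Minimal (· ∈ E) m}.Finite :=
    WellQuasiOrderedLE.finite_of_isAntichain (setOfPred_minimal_antichain _)
  have : Finite {m | Minimal (· ∈ E) m} := hfin
  obtain ⟨ℓ, ⟨e⟩⟩ := Finite.exists_equiv_fin {m | Minimal (· ∈ E) m}
  refine ⟨ℓ, fun i => (e.symm i : Fin r → ℕ), fun _ => K, ?_⟩
  ext y
  simp only [Set.mem_iUnion, Set.mem_image]
  constructor
  · intro hy
    obtain ⟨m, hmy, hm⟩ := exists_minimal_le_of_wellFoundedLT (· ∈ E) y hy
    obtain ⟨d, rfl⟩ := exists_add_of_le hmy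
    exact ⟨e ⟨m, hm⟩, d, (hE m hm.prop d).1 hy, by simp⟩
  · rintro ⟨i, d, hd, rfl⟩
    exact (hE _ (e.symm i).2.prop d).2 hd

/-- The image under the projection onto the last `r` coordinates of the
intersection of a fiber of the first-coordinate projection with a set
`γ + (H ∩ ℕ^{r+1})` belongs to the class `𝒞`. -/
theorem projection_in_C (r : ℕ) (a : ℕ) (γ : Fin (r + 1) → ℕ)
    (H : AddSubgroup (Fin (r + 1) → ℤ)) :
    inC (Fin.tail '' ({n : Fin (r + 1) → ℕ | n 0 = a} ∩
      ((fun s => γ + s) '' natPart H))) := by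
  let f : (Fin r → ℤ) →+ (Fin (r + 1) → ℤ) :=
    { toFun := fun v => Fin.cons 0 v
      map_zero' := by ext i; refine Fin.cases ?_ (fun j => ?_) i <;> simp
      map_add' := fun v w => by ext i; refine Fin.cases ?_ (fun j => ?_) i <;> simp }
  refine inC_of_forall_add_mem_iff (H.comap f) ?_
  rintro _ ⟨_, ⟨hs0, s, hs, rfl⟩, rfl⟩ d
  have hs0' : γ 0 + s 0 = a := hs0
  constructor
  · rintro ⟨_, ⟨ht0, t, ht, rfl⟩, htd⟩
    have ht0' : γ 0 + t 0 = a := ht0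
    have key : f (fun i => (d i : ℤ)) = (fun i => (t i : ℤ)) - fun i => (s i : ℤ) := by
      ext i
      refine Fin.cases ?_ (fun j => ?_) i
      · simp [f]; omega
      · have := congrFun htd j
        simp [Fin.tail] at this
        simp [f]; omega
    change f (fun i => (d i : ℤ)) ∈ H
    rw [key]
    exact H.sub_mem ht hs
  · intro hd
    refine ⟨γ + (s + Fin.cons 0 d), ⟨by simpa using hs0', _, ?_, rfl⟩, ?_⟩
    · have key : (fun i => ((s + Fin.cons 0 d : Fin (r + 1) → ℕ) i : ℤ)) =
          (fun i => (s i : ℤ)) + f (fun i => (d i : ℤ)) := by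
        ext i
        refine Fin.cases ?_ (fun j => ?_) i <;> simp [f]
      change (fun i => ((s + Fin.cons 0 d : Fin (r + 1) → ℕ) i : ℤ)) ∈ H
      rw [key]
      exact H.add_mem hs hd
    · ext j
      simp [Fin.tail, add_assoc]
end

section
/- Let L ⊆ ℕ^r and let β = (β₁,…,β_r) ∈ L. For each i = 1,…,r and each j = 0,…,β_i − 1 set L_{i,j} := {(γ₁,…,γ_r) ∈ L : γ_i = j}, and set L_β := {γ ∈ L : β ≺ γ}. Then L = L_β ∪ ⋃_{i,j} L_{i,j}. Moreover, if L belongs to the class 𝒞, then L_β and each L_{i,j} belong to the class 𝒞. -/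
theorem inC_of_finite {r : ℕ} {ι : Type*} [Finite ι] (γ : ι → (Fin r → ℕ))
    (H : ι → AddSubgroup (Fin r → ℤ)) :
    inC (⋃ i, (fun s => γ i + s) '' natPart (H i)) := by
  obtain ⟨n, ⟨e⟩⟩ := Finite.exists_equiv_fin ι
  exact ⟨n, γ ∘ e.symm, H ∘ e.symm,
    (e.symm.surjective.iUnion_comp fun i => (fun s => γ i + s) '' natPart (H i)).symm⟩

theorem inC_iUnion {r : ℕ} {ι : Type*} [Finite ι] {E : ι → Set (Fin r → ℕ)}
    (h : ∀ i, inC (E i)) : inC (⋃ i, E i) := by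
  choose n γ H hE using h
  have key := inC_of_finite (fun p : Σ i, Fin (n i) => γ p.1 p.2) (fun p => H p.1 p.2)
  rw [Set.iUnion_sigma] at key
  simpa only [← hE] using key

/-- A set stable under translation by `H ∩ ℕ^r` and in which comparable elements differ by
elements of `H` is the union of the translates of `H ∩ ℕ^r` by its finitely many minimal
elements (Dickson's lemma). -/
theorem inC_of_add_mem_of_sub_mem {r : ℕ} {T : Set (Fin r → ℕ)}
    (H : AddSubgroup (Fin r → ℤ))
    (hadd : ∀ m ∈ T, ∀ s ∈ natPart H, m + s ∈ T)
    (hsub : ∀ m ∈ T, ∀ s, m + s ∈ T → s ∈ natPart H) : inC T := by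
  have hfin : {m | Minimal (· ∈ T) m}.Finite :=
    WellQuasiOrderedLE.finite_of_isAntichain (setOfPred_minimal_antichain _)
  have := hfin.to_subtype
  convert inC_of_finite (fun m : {m | Minimal (· ∈ T) m} => m.1) (fun _ => H)
  ext x
  simp only [Set.mem_iUnion, Set.mem_image]
  constructor
  · intro hx
    obtain ⟨m, hmx, hm⟩ := exists_minimal_le_of_wellFoundedLT (· ∈ T) x hx
    obtain ⟨s, rfl⟩ := exists_add_of_le hmx
    exact ⟨⟨m, hm⟩, s, hsub m hm.prop s hx, rfl⟩
  · rintro ⟨m, s, hs, rfl⟩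
    exact hadd m m.2.prop s hs

theorem add_mem_natPart {r : ℕ} {H : AddSubgroup (Fin r → ℤ)} {s t : Fin r → ℕ}
    (hs : s ∈ natPart H) : s + t ∈ natPart H ↔ t ∈ natPart H := by
  simp only [natPart, Set.mem_ofPred_eq, Pi.add_apply, Nat.cast_add] at *
  exact H.add_mem_cancel_left hs

theorem inC_sep_le {r : ℕ} {L : Set (Fin r → ℕ)} (β : Fin r → ℕ) (hL : inC L) :
    inC {γ ∈ L | β ≤ γ} := by
  obtain ⟨n, γ, H, rfl⟩ := hL
  rw [show {x ∈ ⋃ i, (fun s => γ i + s) '' natPart (H i) | β ≤ x} =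
    ⋃ i, {x ∈ (fun s => γ i + s) '' natPart (H i) | β ≤ x} by ext; simp]
  refine inC_iUnion fun i => inC_of_add_mem_of_sub_mem (H i) ?_ ?_
  · rintro _ ⟨⟨t, ht, rfl⟩, hle⟩ s hs
    exact ⟨⟨t + s, (add_mem_natPart ht).2 hs, (add_assoc _ _ _).symm⟩,
      hle.trans le_self_add⟩
  · rintro _ ⟨⟨t, ht, rfl⟩, -⟩ s ⟨⟨u, hu, hus⟩, -⟩
    obtain rfl : u = t + s := add_left_cancel (hus.trans (add_assoc _ _ _))
    exact (add_mem_natPart ht).1 hu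

theorem inC_sep_apply_eq {r : ℕ} {L : Set (Fin r → ℕ)} (k : Fin r) (j : ℕ) (hL : inC L) :
    inC {γ ∈ L | γ k = j} := by
  obtain ⟨n, γ, H, rfl⟩ := hL
  rw [show {x ∈ ⋃ i, (fun s => γ i + s) '' natPart (H i) | x k = j} =
    ⋃ i, {x ∈ (fun s => γ i + s) '' natPart (H i) | x k = j} by ext; simp]
  have hmem (G : AddSubgroup (Fin r → ℤ)) (s : Fin r → ℕ) :
      s ∈ natPart (G ⊓ (Pi.evalAddMonoidHom (fun _ : Fin r => ℤ) k).ker) ↔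
        s ∈ natPart G ∧ s k = 0 := by
    simp [natPart, AddSubgroup.mem_inf, AddMonoidHom.mem_ker]
  refine inC_iUnion fun i => inC_of_add_mem_of_sub_mem
    (H i ⊓ (Pi.evalAddMonoidHom (fun _ : Fin r => ℤ) k).ker) ?_ ?_
  · rintro _ ⟨⟨t, ht, rfl⟩, hk⟩ s hs
    rw [hmem] at hs
    exact ⟨⟨t + s, (add_mem_natPart ht).2 hs.1, (add_assoc _ _ _).symm⟩,
      by rw [Pi.add_apply, hs.2, add_zero, hk]⟩
  · rintro _ ⟨⟨t, ht, rfl⟩, hk⟩ s ⟨⟨u, hu, hus⟩, hk'⟩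
    obtain rfl : u = t + s := add_left_cancel (hus.trans (add_assoc _ _ _))
    rw [Pi.add_apply, hk] at hk'
    exact (hmem _ _).2 ⟨(add_mem_natPart ht).1 hu, by omega⟩

/-- For `L ⊆ ℕ^r` and `β ∈ L`, setting `L_{i,j} = {γ ∈ L : γ_i = j}` (for
`j < β_i`) and `L_β = {γ ∈ L : β ≺ γ}`, we have
`L = L_β ∪ ⋃_{i,j} L_{i,j}`; moreover if `L ∈ 𝒞` then `L_β ∈ 𝒞` and each
`L_{i,j} ∈ 𝒞`. -/
theorem decomposition_of_L (r : ℕ) (L : Set (Fin r → ℕ)) (β : Fin r → ℕ)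
    (hβ : β ∈ L) :
    (L = {γ ∈ L | β ≤ γ} ∪
        ⋃ (i : Fin r) (j : ℕ) (_ : j < β i), {γ ∈ L | γ i = j}) ∧
    (inC L → inC {γ ∈ L | β ≤ γ} ∧
      ∀ (i : Fin r) (j : ℕ), j < β i → inC {γ ∈ L | γ i = j}) := by
  refine ⟨?_, fun hL => ⟨inC_sep_le β hL, fun i j _ => inC_sep_apply_eq i j hL⟩⟩
  ext γ
  simp only [Set.mem_union, Set.mem_iUnion, Set.mem_ofPred_eq]
  constructor
  · intro hγ
    by_cases h : β ≤ γ
    · exact Or.inl ⟨hγ, h⟩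
    · obtain ⟨i, hi⟩ := not_forall.1 h
      exact Or.inr ⟨i, γ i, not_le.1 hi, hγ, rfl⟩
  · rintro (⟨hγ, -⟩ | ⟨_, _, _, hγ, -⟩) <;> exact hγ
end

section
/- Let X be a set, let Φ₁, …, Φ_r : X → X be pairwise commuting maps, let α ∈ X, and let B ⊆ X be a finite subset. Then the set E of tuples (n₁,…,n_r) ∈ ℕ^r for which Φ₁^{n₁} ∘ ⋯ ∘ Φ_r^{n_r}(α) ∈ B belongs to the class 𝒞. -/
theorem List.prod_ofFn_mul_of_commute {M : Type*} [Monoid M] {r : ℕ} (f g : Fin r → M)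
    (h : ∀ i j, Commute (f i) (g j)) :
    (List.ofFn fun i => f i * g i).prod = (List.ofFn f).prod * (List.ofFn g).prod := by
  induction r with
  | zero => simp
  | succ r ih =>
    have hc : Commute (List.ofFn fun i : Fin r => f i.succ).prod (g 0) := by
      refine Commute.list_prod_left _ _ fun x hx => ?_
      obtain ⟨i, rfl⟩ := List.mem_ofFn.1 hx
      exact h _ _
    simp only [List.ofFn_succ, List.prod_cons]
    rw [ih _ _ fun i j => h i.succ j.succ, mul_assoc, mul_assoc, ← mul_assoc (g 0), ← hc.eq,
      mul_assoc]

/-- Every submonoid of `ℕ^r` that is closed under differences lying in `ℕ^r` is the trace on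
`ℕ^r` of a subgroup of `ℤ^r`. -/
theorem exists_natPart_eq {r : ℕ} (M : AddSubmonoid (Fin r → ℕ))
    (hM : ∀ s, ∀ b ∈ M, s + b ∈ M → s ∈ M) :
    ∃ H : AddSubgroup (Fin r → ℤ), natPart H = M := by
  refine ⟨{ carrier := {z | ∃ a ∈ M, ∃ b ∈ M, ∀ i, z i = (a i : ℤ) - b i}
            zero_mem' := ⟨0, M.zero_mem, 0, M.zero_mem, by simp⟩
            add_mem' := ?_
            neg_mem' := ?_ }, ?_⟩
  · rintro x y ⟨a, ha, b, hb, hx⟩ ⟨c, hc, d, hd, hy⟩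
    refine ⟨a + c, M.add_mem ha hc, b + d, M.add_mem hb hd, fun i => ?_⟩
    simp only [Pi.add_apply, hx, hy]
    push_cast
    ring
  · rintro x ⟨a, ha, b, hb, hx⟩
    exact ⟨b, hb, a, ha, fun i => by simp [hx]⟩
  · ext s
    constructor
    · rintro ⟨a, ha, b, hb, hs⟩
      refine hM s b hb ?_
      have : s + b = a := by
        ext i
        have : (s i : ℤ) = a i - b i := hs i
        simp only [Pi.add_apply]
        omega
      rwa [this]
    · intro hs
      exact ⟨s, hs, 0, M.zero_mem, by simp⟩

theorem inC_of_finite_cover {r : ℕ} {E T : Set (Fin r → ℕ)} (hT : T.Finite)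
    (H : (Fin r → ℕ) → AddSubgroup (Fin r → ℤ))
    (hE : E = ⋃ γ ∈ T, (fun s => γ + s) '' natPart (H γ)) : inC E := by
  obtain ⟨ℓ, γ, -, rfl⟩ := hT.fin_param
  exact ⟨ℓ, γ, fun i => H (γ i), by rw [hE, Set.biUnion_range]⟩

theorem inC_setOf_vadd_mem {X : Type*} {r : ℕ} [AddAction (Fin r → ℕ) X] (α : X) {B : Set X}
    (hB : B.Finite) : inC {n : Fin r → ℕ | n +ᵥ α ∈ B} := by
  have hH : ∀ x : X, ∃ H : AddSubgroup (Fin r → ℤ),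
      natPart H = AddAction.stabilizerAddSubmonoid (Fin r → ℕ) x := fun x =>
    exists_natPart_eq _ fun s b hb hsb => by
      rw [AddAction.mem_stabilizerAddSubmonoid_iff] at *
      rwa [add_vadd, hb] at hsb
  choose H hH using hH
  have hT : (⋃ β ∈ B, {n : Fin r → ℕ | Minimal (fun n => n +ᵥ α = β) n}).Finite :=
    hB.biUnion fun β _ => WellQuasiOrderedLE.finite_of_isAntichain (setOfPred_minimal_antichain _)
  refine inC_of_finite_cover hT (fun γ => H (γ +ᵥ α)) ?_
  ext n
  simp only [hH, Set.mem_ofPred_eq, Set.mem_iUnion, Set.mem_image, SetLike.mem_coe,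
    AddAction.mem_stabilizerAddSubmonoid_iff, exists_prop]
  constructor
  · intro hn
    obtain ⟨γ, hγn, hγ⟩ := exists_minimal_le_of_wellFoundedLT
      (fun m : Fin r → ℕ => m +ᵥ α = n +ᵥ α) n rfl
    obtain ⟨s, rfl⟩ := exists_add_of_le hγn
    refine ⟨γ, ⟨_, hn, hγ⟩, s, ?_, rfl⟩
    rw [vadd_vadd, add_comm, hγ.prop]
  · rintro ⟨γ, ⟨β, hβ, hγ⟩, s, hs, rfl⟩
    rwa [add_comm, add_vadd, hs, hγ.prop]

/-- For pairwise commuting self-maps `Φ₁, …, Φ_r` of a set `X`, a point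
`α ∈ X` and a finite subset `B ⊆ X`, the set of tuples `(n₁,…,n_r) ∈ ℕ^r`
with `Φ₁^{n₁} ∘ ⋯ ∘ Φ_r^{n_r}(α) ∈ B` belongs to the class `𝒞`. -/
theorem zero_dimensional (X : Type*) (r : ℕ) (Φ : Fin r → Function.End X)
    (hcomm : ∀ i j, Commute (Φ i) (Φ j)) (α : X) (B : Set X) (hB : B.Finite) :
    inC {n : Fin r → ℕ | (List.ofFn fun i => Φ i ^ n i).prod α ∈ B} := by
  have hzero : (List.ofFn fun i => Φ i ^ (0 : Fin r → ℕ) i).prod = 1 := by simp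
  have hadd (m n : Fin r → ℕ) : (List.ofFn fun i => Φ i ^ (m + n) i).prod =
      (List.ofFn fun i => Φ i ^ m i).prod * (List.ofFn fun i => Φ i ^ n i).prod := by
    rw [← List.prod_ofFn_mul_of_commute _ _ fun i j => (hcomm i j).pow_pow _ _]
    simp only [Pi.add_apply, pow_add]
  let _ : AddAction (Fin r → ℕ) X :=
    { vadd n x := (List.ofFn fun i => Φ i ^ n i).prod x
      zero_vadd x := congrFun hzero x
      add_vadd m n x := congrFun (hadd m n) x }
  exact inC_setOf_vadd_mem α hB
end

section
/- Let K be an imaginary quadratic field with ring of integers 𝔒_K, and let J₁, …, J_r ∈ M₂(𝔒_K) be pairwise commuting 2×2 matrices, each invertible over K. Assume there exists i ∈ {1,…,r} such that J_i is not diagonalizable (over an algebraic closure of K). Then there exists an invertible 2×2 matrix B with entries in K such that for each i = 1,…,r there exist a_i ∈ 𝔒_K and c_i ∈ K with B·J_i·B^{−1} = a_i · [[1, c_i],[0, 1]]. -/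
open NumberField

/-- A square matrix over a field is diagonalizable if it is conjugate, by an
invertible matrix, to a diagonal matrix. -/
def Matrix.IsDiagonalizable {n : Type*} [Fintype n] [DecidableEq n]
    {F : Type*} [Field F] (M : Matrix n n F) : Prop :=
  ∃ P : (Matrix n n F)ˣ,
    ((P : Matrix n n F) * M * ((P⁻¹ : (Matrix n n F)ˣ) : Matrix n n F)).IsDiag

namespace Matrix

variable {F : Type*} [Field F]

theorem IsDiag.isDiagonalizable {n : Type*} [Fintype n] [DecidableEq n] {M : Matrix n n F}
    (h : M.IsDiag) : M.IsDiagonalizable :=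
  ⟨1, by simpa using h⟩

/-- A matrix intertwined with a diagonal one by an invertible matrix is diagonalizable. -/
theorem isDiagonalizable_of_mul_eq {n : Type*} [Fintype n] [DecidableEq n] {M P D : Matrix n n F}
    (hP : P.det ≠ 0) (hD : D.IsDiag) (h : P * M = D * P) : M.IsDiagonalizable := by
  obtain ⟨U, rfl⟩ := (isUnit_iff_isUnit_det P).2 (isUnit_iff_ne_zero.2 hP)
  refine ⟨U, ?_⟩
  rwa [h, mul_assoc, Units.mul_inv, mul_one]

theorem isDiag_fin_two {M : Matrix (Fin 2) (Fin 2) F} (h₁ : M 0 1 = 0) (h₂ : M 1 0 = 0) :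
    M.IsDiag := by
  intro i j hij
  fin_cases i <;> fin_cases j <;> simp_all

/-- Over an algebraically closed field, a `2 × 2` matrix whose characteristic polynomial has
nonzero discriminant is diagonalizable. -/
theorem isDiagonalizable_of_discr_ne_zero [IsAlgClosed F] [NeZero (2 : F)]
    (M : Matrix (Fin 2) (Fin 2) F)
    (h : (M 0 0 - M 1 1) ^ 2 + 4 * M 0 1 * M 1 0 ≠ 0) : M.IsDiagonalizable := by
  have h2 : (2 : F) ≠ 0 := NeZero.ne 2
  obtain ⟨d, hd⟩ := IsAlgClosed.exists_pow_nat_eq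
    ((M 0 0 - M 1 1) ^ 2 + 4 * M 0 1 * M 1 0) (n := 2) two_pos
  have hd0 : d ≠ 0 := by
    rintro rfl
    exact h (by rw [← hd]; ring)
  obtain ⟨x, hx⟩ : ∃ x, 2 * x = M 0 0 + M 1 1 + d :=
    ⟨(M 0 0 + M 1 1 + d) / 2, by field_simp⟩
  obtain ⟨y, hy⟩ : ∃ y, 2 * y = M 0 0 + M 1 1 - d :=
    ⟨(M 0 0 + M 1 1 - d) / 2, by field_simp⟩
  have hyx : y - x ≠ 0 := by
    intro h0
    exact hd0 (mul_left_cancel₀ h2 (by linear_combination hy - hx - 2 * h0))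
  have h4 : (4 : F) ≠ 0 := by
    have := mul_ne_zero h2 h2
    norm_num at this
    exact this
  have root : ∀ z e : F, e ^ 2 = d ^ 2 → 2 * z = M 0 0 + M 1 1 + e →
      (z - M 0 0) * (z - M 1 1) = M 0 1 * M 1 0 := by
    intro z e he hz
    refine mul_left_cancel₀ h4 ?_
    linear_combination (2 * z - M 0 0 - M 1 1 + e) * hz + he + hd
  have hx' := root x d rfl hx
  have hy' := root y (-d) (by ring) (by rw [hy]; ring)
  have hD : (!![x, 0; 0, y] : Matrix (Fin 2) (Fin 2) F).IsDiag :=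
    isDiag_fin_two (by simp) (by simp)
  by_cases hs : M 1 0 = 0
  · by_cases hq : M 0 1 = 0
    · exact (isDiag_fin_two hq hs).isDiagonalizable
    · refine isDiagonalizable_of_mul_eq
        (P := !![x - M 1 1, M 0 1; y - M 1 1, M 0 1]) ?_ hD ?_
      · rw [det_fin_two_of]
        intro h0
        exact mul_ne_zero hq hyx (by linear_combination -h0)
      · ext i j
        fin_cases i <;> fin_cases j <;> simp [mul_apply, Fin.sum_univ_two]
        · linear_combination -hx'
        · ring
        · linear_combination -hy'
        · ring
  · refine isDiagonalizable_of_mul_eq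
      (P := !![M 1 0, x - M 0 0; M 1 0, y - M 0 0]) ?_ hD ?_
    · rw [det_fin_two_of]
      intro h0
      exact mul_ne_zero hs hyx (by linear_combination h0)
    · ext i j
      fin_cases i <;> fin_cases j <;> simp [mul_apply, Fin.sum_univ_two]
      · ring
      · linear_combination -hx'
      · ring
      · linear_combination -hy'

/-- A nonscalar `2 × 2` matrix with a double eigenvalue is conjugate to a Jordan block. -/
theorem exists_mul_eq_jordanBlock_mul [NeZero (2 : F)] (M : Matrix (Fin 2) (Fin 2) F)
    (hdiscr : (M 0 0 - M 1 1) ^ 2 + 4 * M 0 1 * M 1 0 = 0) (hM : ¬ (M 0 1 = 0 ∧ M 1 0 = 0)) :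
    ∃ (B : (Matrix (Fin 2) (Fin 2) F)ˣ) (l : F),
      (B : Matrix (Fin 2) (Fin 2) F) * M = !![l, 1; 0, l] * (B : Matrix (Fin 2) (Fin 2) F) := by
  have h2 : (2 : F) ≠ 0 := NeZero.ne 2
  have h4 : (4 : F) ≠ 0 := by
    have := mul_ne_zero h2 h2
    norm_num at this
    exact this
  obtain ⟨l, hl⟩ : ∃ l, 2 * l = M 0 0 + M 1 1 := ⟨(M 0 0 + M 1 1) / 2, by field_simp⟩
  have hroot : (M 0 0 - l) * (M 1 1 - l) = M 0 1 * M 1 0 := by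
    refine mul_left_cancel₀ h4 ?_
    linear_combination (2 * l - M 0 0 - M 1 1) * hl - hdiscr
  suffices ∃ B : Matrix (Fin 2) (Fin 2) F, B.det ≠ 0 ∧ B * M = !![l, 1; 0, l] * B by
    obtain ⟨B, hB, h⟩ := this
    obtain ⟨U, rfl⟩ := (isUnit_iff_isUnit_det B).2 (isUnit_iff_ne_zero.2 hB)
    exact ⟨U, l, h⟩
  by_cases hq : M 0 1 = 0
  · have hs : M 1 0 ≠ 0 := fun hs => hM ⟨hq, hs⟩
    have h0 : M 0 0 - M 1 1 = 0 := by
      refine pow_eq_zero_iff two_ne_zero |>.1 ?_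
      linear_combination hdiscr - 4 * M 1 0 * hq
    have hl0 : M 0 0 = l := mul_left_cancel₀ h2 (by linear_combination h0 - hl)
    have hl1 : M 1 1 = l := by linear_combination hl0 - h0
    refine ⟨!![0, 1; M 1 0, 0], by simpa [det_fin_two_of] using hs, ?_⟩
    ext i j
    fin_cases i <;> fin_cases j <;> simp [mul_apply, Fin.sum_univ_two, hq, hl0, hl1, mul_comm]
  · refine ⟨!![1, 0; M 0 0 - l, M 0 1], by simpa [det_fin_two_of] using hq, ?_⟩
    ext i j
    fin_cases i <;> fin_cases j <;> simp [mul_apply, Fin.sum_univ_two]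
    · linear_combination -hroot - (M 0 0 - l) * hl
    · linear_combination -(M 0 1) * hl

/-- The centralizer of a `2 × 2` Jordan block. -/
theorem eq_of_commute_jordanBlock {l : F} {X : Matrix (Fin 2) (Fin 2) F}
    (h : Commute X !![l, 1; 0, l]) : X = !![X 0 0, X 0 1; 0, X 0 0] := by
  have h00 := congrFun (congrFun h.eq 0) 0
  have h01 := congrFun (congrFun h.eq 0) 1
  simp [mul_apply, Fin.sum_univ_two] at h00 h01
  have hs : X 1 0 = 0 := by linear_combination -h00
  have ht : X 1 1 = X 0 0 := by linear_combination -h01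
  ext i j
  fin_cases i <;> fin_cases j <;> simp [hs, ht]

end Matrix

/-- Let `K` be an imaginary quadratic field with ring of integers `𝔒_K`, and
let `J₁, …, J_r ∈ M₂(𝔒_K)` be pairwise commuting matrices, invertible over
`K`, at least one of which is not diagonalizable over an algebraic closure of
`K`. Then there is `B ∈ GL₂(K)` such that for every `i` there are
`aᵢ ∈ 𝔒_K` and `cᵢ ∈ K` with `B Jᵢ B⁻¹ = aᵢ • [[1, cᵢ],[0,1]]`. -/
theorem simultaneous_triangularization (K : Type*) [Field K] [NumberField K]
    (hdeg : Module.finrank ℚ K = 2) (himag : ∀ φ : K →+* ℝ, False)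
    (r : ℕ) (J : Fin r → Matrix (Fin 2) (Fin 2) (RingOfIntegers K))
    (hcomm : ∀ i j, Commute (J i) (J j))
    (hinv : ∀ i, IsUnit ((J i).map (algebraMap (RingOfIntegers K) K)))
    (i₀ : Fin r)
    (hnd : ¬ ((J i₀).map ((algebraMap K (AlgebraicClosure K)).comp
        (algebraMap (RingOfIntegers K) K))).IsDiagonalizable) :
    ∃ B : (Matrix (Fin 2) (Fin 2) K)ˣ, ∀ i : Fin r,
      ∃ (a : RingOfIntegers K) (c : K),
        (B : Matrix (Fin 2) (Fin 2) K) *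
            (J i).map (algebraMap (RingOfIntegers K) K) *
            ((B⁻¹ : (Matrix (Fin 2) (Fin 2) K)ˣ) : Matrix (Fin 2) (Fin 2) K)
          = (algebraMap (RingOfIntegers K) K a) • !![1, c; 0, 1] := by
  set f := algebraMap (RingOfIntegers K) K
  set g := algebraMap K (AlgebraicClosure K)
  have hdiscr : ((J i₀).map f 0 0 - (J i₀).map f 1 1) ^ 2
      + 4 * (J i₀).map f 0 1 * (J i₀).map f 1 0 = 0 := by
    by_contra hne
    refine hnd (Matrix.isDiagonalizable_of_discr_ne_zero _ fun h0 => hne (g.injective ?_))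
    simpa [map_ofNat] using h0
  have hoff : ¬ ((J i₀).map f 0 1 = 0 ∧ (J i₀).map f 1 0 = 0) := fun ⟨hq, hs⟩ =>
    hnd (Matrix.isDiag_fin_two
      ((congrArg g hq).trans (map_zero g)) ((congrArg g hs).trans (map_zero g))).isDiagonalizable
  obtain ⟨B, l, hB⟩ := Matrix.exists_mul_eq_jordanBlock_mul _ hdiscr hoff
  refine ⟨B, fun i => ?_⟩
  set C := (J i).map f
  set X := (B : Matrix (Fin 2) (Fin 2) K) * C * ((B⁻¹ : (Matrix (Fin 2) (Fin 2) K)ˣ) :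
    Matrix (Fin 2) (Fin 2) K) with hXdef
  have hX : X = !![X 0 0, X 0 1; 0, X 0 0] := by
    have hconj : (B : Matrix (Fin 2) (Fin 2) K) * (J i₀).map f *
        ((B⁻¹ : (Matrix (Fin 2) (Fin 2) K)ˣ) : Matrix (Fin 2) (Fin 2) K) = !![l, 1; 0, l] := by
      rw [hB, mul_assoc, Units.mul_inv, mul_one]
    have hC : Commute C ((J i₀).map f) := (hcomm i i₀).map f.mapMatrix
    refine Matrix.eq_of_commute_jordanBlock (l := l) ?_
    rw [← hconj]
    simp only [Commute, SemiconjBy, hXdef, mul_assoc, Units.inv_mul_cancel_left]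
    rw [← mul_assoc C, hC.eq, mul_assoc]
  have hdet : X 0 0 ^ 2 = f (J i).det := by
    have h1 : X.det = C.det := Matrix.det_units_conj B C
    rw [hX, Matrix.det_fin_two_of] at h1
    rw [f.map_det]
    exact (by ring : X 0 0 ^ 2 = X 0 0 * X 0 0 - X 0 1 * 0).trans h1
  have hne : X 0 0 ≠ 0 := by
    intro h0
    have hu := (Matrix.isUnit_iff_isUnit_det _).1 (hinv i)
    refine hu.ne_zero ((f.map_det (J i)).symm.trans ?_)
    rw [← hdet, h0, zero_pow two_ne_zero]
  obtain ⟨a, ha⟩ : ∃ a, f a = X 0 0 :=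
    IsIntegrallyClosed.isIntegral_iff.1
      (IsIntegral.of_pow two_pos (hdet ▸ isIntegral_algebraMap))
  refine ⟨a, X 0 1 / X 0 0, ?_⟩
  rw [ha, hX]
  ext j k
  fin_cases j <;> fin_cases k <;> simp [mul_div_cancel₀, hne]
end

section
/- Let F be a field of characteristic zero, and let c₁, …, c_r, B ∈ F. Then the set E = {(n₁,…,n_r) ∈ ℕ^r : c₁·n₁ + ⋯ + c_r·n_r = B} belongs to the class 𝒞; in fact E is a finite union of sets τ + (H ∩ ℕ^r), where H := {(m₁,…,m_r) ∈ ℤ^r : c₁·m₁ + ⋯ + c_r·m_r = 0} and the τ run over the minimal elements of E with respect to the componentwise order. -/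
theorem inC_biUnion_image {r : ℕ} {T : Set (Fin r → ℕ)} (hT : T.Finite)
    (H : AddSubgroup (Fin r → ℤ)) :
    inC (⋃ τ ∈ T, (fun s => τ + s) '' natPart H) := by
  obtain ⟨ℓ, γ, -, rfl⟩ := hT.fin_param
  exact ⟨ℓ, γ, fun _ => H, by rw [Set.biUnion_range]⟩

theorem finite_setOf_minimal {α : Type*} [PartialOrder α] [WellQuasiOrderedLE α] (E : Set α) :
    {τ ∈ E | ∀ β ∈ E, β ≤ τ → β = τ}.Finite :=
  WellQuasiOrderedLE.finite_of_isAntichain fun _ hx _ hy hne hle => hne (hy.2 _ hx.1 hle)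

/-- The integer relations `∑ mᵢ cᵢ = 0` among the `cᵢ`. -/
def integerRelations {F : Type*} [Field F] {r : ℕ} (c : Fin r → F) :
    AddSubgroup (Fin r → ℤ) :=
  (Fintype.linearCombination ℤ c).toAddMonoidHom.ker

theorem mem_integerRelations {F : Type*} [Field F] {r : ℕ} {c : Fin r → F} {m : Fin r → ℤ} :
    m ∈ integerRelations c ↔ ∑ i, (m i : F) * c i = 0 := by
  simp [integerRelations, AddMonoidHom.mem_ker, Fintype.linearCombination_apply]

theorem mem_natPart_integerRelations {F : Type*} [Field F] {r : ℕ} {c : Fin r → F}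
    {n : Fin r → ℕ} :
    n ∈ natPart (integerRelations c) ↔ ∑ i, (n i : F) * c i = 0 := by
  simp [natPart, mem_integerRelations]

theorem setOf_linear_eq_biUnion_minimal {F : Type*} [Field F] {r : ℕ} (c : Fin r → F) (B : F) :
    {n : Fin r → ℕ | ∑ i, (n i : F) * c i = B}
      = ⋃ τ ∈ {τ ∈ {n : Fin r → ℕ | ∑ i, (n i : F) * c i = B} |
          ∀ β ∈ {n : Fin r → ℕ | ∑ i, (n i : F) * c i = B}, β ≤ τ → β = τ},
        (fun s => τ + s) '' natPart (integerRelations c) := by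
  have hadd (τ s : Fin r → ℕ) : ∑ i, (((τ + s) i : ℕ) : F) * c i =
      ∑ i, (τ i : F) * c i + ∑ i, (s i : F) * c i := by
    simp [add_mul, Finset.sum_add_distrib]
  ext n
  simp only [Set.mem_iUnion, Set.mem_image, mem_natPart_integerRelations, exists_prop]
  constructor
  · intro hn
    obtain ⟨τ, hle, hτ⟩ := (Set.isPWO_of_wellQuasiOrderedLE _).exists_le_minimal hn
    refine ⟨τ, ⟨hτ.prop, fun β hβ h => hτ.eq_of_le hβ h⟩, n - τ, ?_, add_tsub_cancel_of_le hle⟩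
    have h := hadd τ (n - τ)
    rw [add_tsub_cancel_of_le hle, hn, hτ.prop] at h
    exact left_eq_add.mp h
  · rintro ⟨τ, ⟨hτ, -⟩, s, hs, rfl⟩
    rw [Set.mem_ofPred_eq, hadd, hs, add_zero]
    exact hτ

/-- For a field `F` of characteristic zero and `c₁, …, c_r, B ∈ F`, the set
`E = {(n₁,…,n_r) ∈ ℕ^r : ∑ cᵢ nᵢ = B}` belongs to the class `𝒞`; in fact it
is the union, over the (finitely many) minimal elements `τ` of `E`, of the
sets `τ + (H ∩ ℕ^r)`, where `H = {m ∈ ℤ^r : ∑ cᵢ mᵢ = 0}`. -/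
theorem linear_equation_in_C (F : Type*) [Field F] [CharZero F] (r : ℕ)
    (c : Fin r → F) (B : F) :
    inC {n : Fin r → ℕ | ∑ i, (n i : F) * c i = B} ∧
    ∃ H : AddSubgroup (Fin r → ℤ),
      (∀ m : Fin r → ℤ, m ∈ H ↔ ∑ i, (m i : F) * c i = 0) ∧
      {τ ∈ {n : Fin r → ℕ | ∑ i, (n i : F) * c i = B} |
        ∀ β ∈ {n : Fin r → ℕ | ∑ i, (n i : F) * c i = B},
          β ≤ τ → β = τ}.Finite ∧
      {n : Fin r → ℕ | ∑ i, (n i : F) * c i = B}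
        = ⋃ τ ∈ {τ ∈ {n : Fin r → ℕ | ∑ i, (n i : F) * c i = B} |
            ∀ β ∈ {n : Fin r → ℕ | ∑ i, (n i : F) * c i = B},
              β ≤ τ → β = τ},
          (fun s => τ + s) '' natPart H := by
  refine ⟨?_, integerRelations c, fun m => mem_integerRelations, finite_setOf_minimal _,
    setOf_linear_eq_biUnion_minimal c B⟩
  rw [setOf_linear_eq_biUnion_minimal c B]
  exact inC_biUnion_image (finite_setOf_minimal _) _
end

section
/- Let K be an imaginary quadratic field with ring of integers 𝔒_K, let a₁, …, a_r ∈ 𝔒_K be nonzero, and let A ∈ K. Then the set of tuples (n₁,…,n_r) ∈ ℕ^r satisfying a₁^{n₁} ⋯ a_r^{n_r} = A belongs to the class 𝒞. -/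
open NumberField

/-- The exponent vectors of the multiplicative relations among the units `u`. -/
def multiplicativeRelations {G : Type*} [CommGroup G] {r : ℕ} (u : Fin r → G) :
    AddSubgroup (Fin r → ℤ) where
  carrier := {m | ∏ i, u i ^ m i = 1}
  zero_mem' := by simp
  add_mem' {m k} hm hk := by
    simp only [Set.mem_ofPred_eq] at hm hk ⊢
    simp [zpow_add, Finset.prod_mul_distrib, hm, hk]
  neg_mem' {m} hm := by
    simp only [Set.mem_ofPred_eq] at hm ⊢
    simp [hm]

theorem mem_natPart_multiplicativeRelations {G : Type*} [CommGroup G] {r : ℕ} (u : Fin r → G)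
    (n : Fin r → ℕ) :
    n ∈ natPart (multiplicativeRelations u) ↔ ∏ i, u i ^ n i = 1 := by
  simp [natPart, multiplicativeRelations, ← AddSubgroup.mem_carrier]

/-- A set that is stable under adding elements of `H`, and in which comparable elements differ by
elements of `H`, belongs to the class `𝒞`: by Dickson's lemma it has finitely many minimal
elements. -/
theorem inC_of_add_mem_iff {r : ℕ} (E : Set (Fin r → ℕ)) (H : AddSubgroup (Fin r → ℤ))
    (hE : ∀ γ ∈ E, ∀ s, γ + s ∈ E ↔ s ∈ natPart H) : inC E := by
  have hfin : {n | Minimal (· ∈ E) n}.Finite :=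
    WellQuasiOrderedLE.finite_of_isAntichain (setOfPred_minimal_antichain _)
  obtain ⟨ℓ, γ, -, hγ⟩ := hfin.fin_param
  refine ⟨ℓ, γ, fun _ => H, ?_⟩
  ext n
  simp only [Set.mem_iUnion, Set.mem_image]
  constructor
  · intro hn
    obtain ⟨m, hmn, hm⟩ := exists_minimal_le_of_wellFoundedLT (· ∈ E) n hn
    obtain ⟨i, rfl⟩ : m ∈ Set.range γ := hγ ▸ hm
    obtain ⟨s, rfl⟩ := le_iff_exists_add.mp hmn
    exact ⟨i, s, (hE _ hm.prop s).mp hn, rfl⟩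
  · rintro ⟨i, s, hs, rfl⟩
    have hi : γ i ∈ {n | Minimal (· ∈ E) n} := hγ ▸ Set.mem_range_self i
    exact (hE _ hi.prop s).mpr hs

/-- Let `K` be an imaginary quadratic field with ring of integers `𝔒_K`, let
`a₁, …, a_r ∈ 𝔒_K` be nonzero and let `A ∈ K`. Then the set of tuples
`(n₁,…,n_r) ∈ ℕ^r` with `a₁^{n₁}⋯a_r^{n_r} = A` belongs to the class `𝒞`. -/
theorem multiplicative_equation_in_C (K : Type*) [Field K] [NumberField K]
    (hdeg : Module.finrank ℚ K = 2) (himag : ∀ φ : K →+* ℝ, False)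
    (r : ℕ) (a : Fin r → RingOfIntegers K) (ha : ∀ i, a i ≠ 0) (A : K) :
    inC {n : Fin r → ℕ |
      ∏ i, (algebraMap (RingOfIntegers K) K (a i)) ^ n i = A} := by
  have hb : ∀ i, algebraMap (RingOfIntegers K) K (a i) ≠ 0 := fun i =>
    RingOfIntegers.coe_ne_zero_iff.mpr (ha i)
  refine inC_of_add_mem_iff _ (multiplicativeRelations fun i => Units.mk0 _ (hb i)) ?_
  rintro γ rfl s
  have hγ : ∏ i, algebraMap (RingOfIntegers K) K (a i) ^ γ i ≠ 0 :=
    Finset.prod_ne_zero_iff.mpr fun i _ => pow_ne_zero _ (hb i)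
  rw [mem_natPart_multiplicativeRelations, Units.ext_iff]
  simp only [Set.mem_ofPred_eq, Pi.add_apply, pow_add, Finset.prod_mul_distrib, Units.coe_prod,
    Units.val_pow_eq_pow_val, Units.val_mk0, Units.val_one]
  exact mul_eq_left₀ hγ
end

section
/- Let K be an imaginary quadratic field with ring of integers 𝔒_K, let a₁, …, a_r ∈ 𝔒_K be nonzero, let A, c₁, …, c_r ∈ 𝔒_K, and let B ∈ 𝔒_K be nonzero. Consider the set E of tuples (n₁,…,n_r) ∈ ℕ^r satisfying a₁^{n₁}⋯a_r^{n_r} · (A + c₁·n₁ + ⋯ + c_r·n_r) = B. Then (i) the set of values {a₁^{n₁}⋯a_r^{n_r} : (n₁,…,n_r) ∈ E} is finite, and (ii) E belongs to the class 𝒞. -/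
open NumberField

/-- A subset of `ℕ^r` which is stable under translation by `H ∩ ℕ^r`, and which splits into
finitely many pieces each lying in a single coset of `H`, belongs to the class `𝒞`. -/
theorem inC_of_finite_image {r : ℕ} {α : Type*} {E : Set (Fin r → ℕ)}
    (H : AddSubgroup (Fin r → ℤ)) (f : (Fin r → ℕ) → α) (hfin : (f '' E).Finite)
    (hadd : ∀ n ∈ E, ∀ s ∈ natPart H, n + s ∈ E)
    (hsub : ∀ m ∈ E, ∀ n ∈ E, f m = f n → (fun i => (n i : ℤ) - m i) ∈ H) : inC E := by
  let M : Set (Fin r → ℕ) := ⋃ y ∈ f '' E, {m | Minimal (fun n => n ∈ E ∧ f n = y) m}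
  have hM : M.Finite := hfin.biUnion fun y _ =>
    WellQuasiOrderedLE.finite_of_isAntichain (setOfPred_minimal_antichain _)
  have hME : ∀ m ∈ M, m ∈ E := by
    intro m hm
    obtain ⟨y, _, hm⟩ := Set.mem_iUnion₂.1 hm
    exact (Set.mem_ofPred_eq ▸ hm : Minimal _ m).prop.1
  obtain ⟨ℓ, γ, hγ⟩ := hM.fin_embedding
  refine ⟨ℓ, γ, fun _ => H, Set.Subset.antisymm (fun n hn => ?_) (Set.iUnion_subset fun i => ?_)⟩
  · obtain ⟨m, hmn, hm⟩ :=
      exists_minimal_le_of_wellFoundedLT (fun k => k ∈ E ∧ f k = f n) n ⟨hn, rfl⟩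
    have hmM : m ∈ M := Set.mem_biUnion (Set.mem_image_of_mem f hn) hm
    rw [← hγ] at hmM
    obtain ⟨i, rfl⟩ := hmM
    refine Set.mem_iUnion.2 ⟨i, n - γ i, ?_, add_tsub_cancel_of_le hmn⟩
    have h := hsub _ hm.prop.1 n hn hm.prop.2
    simpa only [natPart, Set.mem_ofPred_eq, Pi.sub_apply, Nat.cast_sub (hmn _)] using h
  · rintro _ ⟨s, hs, rfl⟩
    exact hadd _ (hME _ (hγ ▸ Set.mem_range_self i)) s hs

/-- In a number field with a single infinite place, a nonzero algebraic integer has only finitely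
many divisors. -/
theorem finite_setOf_dvd_of_subsingleton_infinitePlace {K : Type*} [Field K] [NumberField K]
    [Subsingleton (InfinitePlace K)] {B : 𝓞 K} (hB : B ≠ 0) : {D : 𝓞 K | D ∣ B}.Finite := by
  let w : InfinitePlace K := Classical.arbitrary _
  refine Set.Finite.of_finite_image ((Embeddings.finite_of_norm_le K ℂ (w B)).subset ?_)
    RingOfIntegers.coe_injective.injOn
  rintro _ ⟨D, ⟨D', rfl⟩, rfl⟩
  refine ⟨D.isIntegral_coe, fun φ => ?_⟩
  have h1 : 1 ≤ w D' := InfinitePlace.one_le_of_lt_one (right_ne_zero_of_mul hB)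
    fun {z} hz => (hz (Subsingleton.elim z w)).elim
  rw [← InfinitePlace.apply φ, Subsingleton.elim (InfinitePlace.mk φ) w,
    show w ((D * D' : 𝓞 K) : K) = w (D : K) * w (D' : K) from map_mul w (D : K) D']
  exact le_mul_of_one_le_right (apply_nonneg w _) h1

theorem subsingleton_infinitePlace_of_finrank_eq_two {K : Type*} [Field K] [NumberField K]
    (hdeg : Module.finrank ℚ K = 2) (himag : IsEmpty (K →+* ℝ)) :
    Subsingleton (InfinitePlace K) := by
  have : IsTotallyComplex K := ⟨fun w => by
    rw [← InfinitePlace.not_isReal_iff_isComplex]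
    rintro ⟨φ, hφ, -⟩
    exact himag.false hφ.embedding⟩
  have h := IsTotallyComplex.finrank K
  have h0 := IsTotallyComplex.nrRealPlaces_eq_zero K
  have hc := InfinitePlace.card_eq_nrRealPlaces_add_nrComplexPlaces K
  rw [← Fintype.card_le_one_iff_subsingleton]
  omega

/-- The subgroup of exponents `z ∈ ℤ^r` with `∏ aᵢ ^ zᵢ = 1` and `∑ zᵢ cᵢ = 0`. -/
def relationSubgroup {K : Type*} [Field K] {r : ℕ} (a : Fin r → K) (ha : ∀ i, a i ≠ 0)
    (c : Fin r → K) : AddSubgroup (Fin r → ℤ) where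
  carrier := {z | ∏ i, a i ^ z i = 1 ∧ ∑ i, (z i : K) * c i = 0}
  zero_mem' := by simp
  add_mem' := by
    rintro x y ⟨hx, hx'⟩ ⟨hy, hy'⟩
    constructor
    · simp [zpow_add₀ (ha _), Finset.prod_mul_distrib, hx, hy]
    · simp [add_mul, Finset.sum_add_distrib, hx', hy']
  neg_mem' := by
    rintro x ⟨hx, hx'⟩
    constructor
    · simp [hx]
    · simp [hx']

theorem mem_relationSubgroup {K : Type*} [Field K] {r : ℕ} {a : Fin r → K} {ha : ∀ i, a i ≠ 0}
    {c : Fin r → K} {z : Fin r → ℤ} :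
    z ∈ relationSubgroup a ha c ↔ ∏ i, a i ^ z i = 1 ∧ ∑ i, (z i : K) * c i = 0 :=
  Iff.rfl

/-- Let `K` be an imaginary quadratic field with ring of integers `𝔒_K`, let
`a₁, …, a_r ∈ 𝔒_K` be nonzero, let `A, c₁, …, c_r ∈ 𝔒_K` and let `B ∈ 𝔒_K`
be nonzero. Consider the set `E` of tuples `(n₁,…,n_r) ∈ ℕ^r` with
`a₁^{n₁}⋯a_r^{n_r}·(A + ∑ cᵢ nᵢ) = B`. Then the set of values
`a₁^{n₁}⋯a_r^{n_r}` for `(n₁,…,n_r) ∈ E` is finite, and `E` belongs to the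
class `𝒞`. -/
theorem mixed_equation_in_C (K : Type*) [Field K] [NumberField K]
    (hdeg : Module.finrank ℚ K = 2) (himag : ∀ φ : K →+* ℝ, False)
    (r : ℕ) (a : Fin r → RingOfIntegers K) (ha : ∀ i, a i ≠ 0)
    (A : RingOfIntegers K) (c : Fin r → RingOfIntegers K)
    (B : RingOfIntegers K) (hB : B ≠ 0) :
    ((fun n : Fin r → ℕ => ∏ i, a i ^ n i) ''
      {n : Fin r → ℕ |
        (∏ i, a i ^ n i) * (A + ∑ i, (n i : RingOfIntegers K) * c i)
          = B}).Finite ∧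
    inC {n : Fin r → ℕ |
      (∏ i, a i ^ n i) * (A + ∑ i, (n i : RingOfIntegers K) * c i) = B} := by
  have := subsingleton_infinitePlace_of_finrank_eq_two hdeg ⟨himag⟩
  have hfin : ((fun n : Fin r → ℕ => ∏ i, a i ^ n i) '' {n : Fin r → ℕ |
      (∏ i, a i ^ n i) * (A + ∑ i, (n i : RingOfIntegers K) * c i) = B}).Finite := by
    refine (finite_setOf_dvd_of_subsingleton_infinitePlace hB).subset ?_
    rintro _ ⟨n, hn, rfl⟩
    exact Dvd.intro _ hn
  have ha' : ∀ i, (a i : K) ≠ 0 := fun i => RingOfIntegers.coe_ne_zero_iff.2 (ha i)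
  refine ⟨hfin, inC_of_finite_image (relationSubgroup (fun i => (a i : K)) ha'
    (fun i => (c i : K))) _ hfin ?_ ?_⟩
  · rintro n hn s ⟨hs, hs'⟩
    have hs : ∏ i, a i ^ s i = 1 := RingOfIntegers.coe_injective (by simpa using hs)
    have hs' : ∑ i, (s i : 𝓞 K) * c i = 0 := RingOfIntegers.coe_injective (by simpa using hs')
    simpa [pow_add, Finset.prod_mul_distrib, add_mul, Finset.sum_add_distrib, hs, hs'] using hn
  · intro m hm n hn hmn
    have hprod : ∏ i, a i ^ m i = ∏ i, a i ^ n i := hmn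
    have hne : ∏ i, a i ^ n i ≠ 0 := Finset.prod_ne_zero_iff.2 fun i _ => pow_ne_zero _ (ha i)
    have hsum : ∑ i, (n i : 𝓞 K) * c i = ∑ i, (m i : 𝓞 K) * c i := by
      rw [Set.mem_ofPred_eq, hprod] at hm
      exact add_left_cancel (mul_left_cancel₀ hne (hn.trans hm.symm))
    have hprodK : ∏ i, (a i : K) ^ m i = ∏ i, (a i : K) ^ n i := by
      simpa using congrArg (algebraMap (𝓞 K) K) hprod
    have hsumK : ∑ i, (n i : K) * (c i : K) = ∑ i, (m i : K) * (c i : K) := by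
      simpa using congrArg (algebraMap (𝓞 K) K) hsum
    refine mem_relationSubgroup.2 ⟨?_, ?_⟩
    · simp only [zpow_sub₀ (ha' _), zpow_natCast, Finset.prod_div_distrib, hprodK]
      exact div_self (Finset.prod_ne_zero_iff.2 fun i _ => pow_ne_zero _ (ha' i))
    · simp [sub_mul, Finset.sum_sub_distrib, hsumK]
end

section
/- Let F be a field of characteristic zero, let V be an F-vector space, let J₁, …, J_r be pairwise commuting invertible linear transformations of V, let u₀ ∈ V, and let L be a one-dimensional linear subspace of V. Then the set E = {(n₁,…,n_r) ∈ ℕ^r : J₁^{n₁}⋯J_r^{n_r}(u₀) ∈ L} is either empty or equal to (γ + H) ∩ ℕ^r for some γ ∈ ℤ^r and some subgroup H ⊆ ℤ^r; in particular, E belongs to the class 𝒞. -/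
/-- A coset of a subgroup of `ℤ^r` meets `ℕ^r` in a set of class `𝒞`: by Dickson's lemma,
the intersection is the union of the translates of `H ∩ ℕ^r` by its finitely many minimal
elements. -/
lemma inC_setOf_sub_mem {r : ℕ} (γ : Fin r → ℤ) (H : AddSubgroup (Fin r → ℤ)) :
    inC {n : Fin r → ℕ | (fun i => (n i : ℤ)) - γ ∈ H} := by
  set E : Set (Fin r → ℕ) := {n | (fun i => (n i : ℤ)) - γ ∈ H} with hE
  have hfin : {m | Minimal (· ∈ E) m}.Finite :=
    WellQuasiOrderedLE.finite_of_isAntichain (setOfPred_minimal_antichain _)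
  obtain ⟨ℓ, f, -, hf⟩ := hfin.fin_param
  refine ⟨ℓ, f, fun _ => H, ?_⟩
  ext n
  simp only [Set.mem_iUnion, Set.mem_image]
  constructor
  · intro hn
    obtain ⟨m, hmn, hm⟩ := (Set.isPWO_of_wellQuasiOrderedLE E).exists_le_minimal hn
    obtain ⟨i, rfl⟩ : m ∈ Set.range f := hf ▸ hm
    refine ⟨i, n - f i, ?_, add_tsub_cancel_of_le hmn⟩
    have hsub := H.sub_mem hn hm.prop
    rw [sub_sub_sub_cancel_right] at hsub
    have heq : (fun j => ((n - f i) j : ℤ)) = (fun j => (n j : ℤ)) - fun j => (f i j : ℤ) :=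
      funext fun j => Nat.cast_sub (hmn j)
    rw [natPart, Set.mem_ofPred_eq, heq]
    exact hsub
  · rintro ⟨i, s, hs, rfl⟩
    have hi : Minimal (· ∈ E) (f i) := hf.subset (Set.mem_range_self i)
    have hadd := H.add_mem hi.prop hs
    rw [hE, Set.mem_ofPred_eq]
    convert hadd using 1
    ext j
    simp only [Pi.add_apply, Pi.sub_apply, Nat.cast_add]
    ring

open scoped IsMulCommutative in
/-- A finite family of pairwise commuting elements `g i` of a group induces a homomorphism from
`ℤ^r` sending `n` to `∏ g i ^ n i`. -/
lemma exists_hom_eq_prod_pow_of_commute {G : Type*} [Group G] {r : ℕ} (g : Fin r → G)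
    (hcomm : ∀ i j, Commute (g i) (g j)) :
    ∃ φ : Multiplicative (Fin r → ℤ) →* G, ∀ n : Fin r → ℕ,
      φ (Multiplicative.ofAdd fun i => (n i : ℤ)) = (List.ofFn fun i => g i ^ n i).prod := by
  have hK : IsMulCommutative (Subgroup.closure (Set.range g)) :=
    Subgroup.isMulCommutative_closure (by rintro _ ⟨i, rfl⟩ _ ⟨j, rfl⟩; exact hcomm i j)
  let g' (i : Fin r) : Subgroup.closure (Set.range g) :=
    ⟨g i, Subgroup.subset_closure (Set.mem_range_self i)⟩
  let ψ : Multiplicative (Fin r → ℤ) →* Subgroup.closure (Set.range g) :=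
    { toFun := fun n => ∏ i, g' i ^ n.toAdd i
      map_one' := by simp
      map_mul' := fun m n => by simp [zpow_add, Finset.prod_mul_distrib] }
  refine ⟨(Subgroup.subtype _).comp ψ, fun n => ?_⟩
  have hψ : ψ (Multiplicative.ofAdd fun i => (n i : ℤ)) = (List.ofFn fun i => g' i ^ n i).prod := by
    simp [ψ, List.prod_ofFn]
  rw [MonoidHom.comp_apply, hψ, map_list_prod, List.map_ofFn]
  rfl

/-- If an additive group `A` acts linearly on `V`, the elements of `A` sending `w` to a multiple of
itself form a subgroup. -/
def eigenSubgroup {F V A : Type*} [Field F] [AddCommGroup V] [Module F V] [AddGroup A]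
    (φ : Multiplicative A →* (V ≃ₗ[F] V)) (w : V) : AddSubgroup A where
  carrier := {a | ∃ c : F, φ (Multiplicative.ofAdd a) w = c • w}
  zero_mem' := ⟨1, by simp⟩
  add_mem' := by
    rintro a b ⟨c, hc⟩ ⟨d, hd⟩
    exact ⟨d * c, by rw [ofAdd_add, map_mul, LinearEquiv.mul_apply, hd, map_smul, hc, mul_smul]⟩
  neg_mem' := by
    rintro a ⟨c, hc⟩
    refine ⟨c⁻¹, ?_⟩
    have hw : w = c • φ (Multiplicative.ofAdd (-a)) w := by
      rw [← map_smul, ← hc, ← LinearEquiv.mul_apply, ← map_mul, ← ofAdd_add]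
      simp
    rcases eq_or_ne c 0 with rfl | h0
    · rw [zero_smul] at hw
      simp [hw]
    · rw [eq_inv_smul_iff₀ h0]
      exact hw.symm

lemma mem_eigenSubgroup {F V A : Type*} [Field F] [AddCommGroup V] [Module F V] [AddGroup A]
    {φ : Multiplicative A →* (V ≃ₗ[F] V)} {w : V} {a : A} :
    a ∈ eigenSubgroup φ w ↔ ∃ c : F, φ (Multiplicative.ofAdd a) w = c • w :=
  Iff.rfl

/-- If `a₀` sends `u` into the line `L`, then the elements sending `u` into `L` form the coset
through `a₀` of the subgroup of elements having `a₀ u` as an eigenvector. -/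
lemma apply_mem_iff_sub_mem_eigenSubgroup {F V A : Type*} [Field F] [AddCommGroup V] [Module F V]
    [AddGroup A] (φ : Multiplicative A →* (V ≃ₗ[F] V)) {u : V} {L : Submodule F V}
    (hL : Module.finrank F L = 1) {a₀ : A} (h₀ : φ (Multiplicative.ofAdd a₀) u ∈ L) (a : A) :
    φ (Multiplicative.ofAdd a) u ∈ L ↔
      a - a₀ ∈ eigenSubgroup φ (φ (Multiplicative.ofAdd a₀) u) := by
  rw [mem_eigenSubgroup, ← LinearEquiv.mul_apply, ← map_mul, ← ofAdd_add, sub_add_cancel]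
  refine ⟨fun ha => ?_, fun ⟨c, hc⟩ => hc ▸ L.smul_mem c h₀⟩
  rcases eq_or_ne u 0 with rfl | hu
  · exact ⟨0, by simp⟩
  · have hne : (⟨_, h₀⟩ : L) ≠ 0 := by simpa [Subtype.ext_iff] using hu
    obtain ⟨c, hc⟩ := (finrank_eq_one_iff_of_nonzero' _ hne).mp hL ⟨_, ha⟩
    exact ⟨c, (congrArg Subtype.val hc).symm⟩

/-- Let `F` be a field of characteristic zero, `V` an `F`-vector space,
`J₁, …, J_r` pairwise commuting invertible linear transformations of `V`,
`u₀ ∈ V` and `L ⊆ V` a one-dimensional subspace. Then the set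
`E = {(n₁,…,n_r) ∈ ℕ^r : J₁^{n₁}⋯J_r^{n_r}(u₀) ∈ L}` is either empty or of
the form `(γ + H) ∩ ℕ^r` for some `γ ∈ ℤ^r` and subgroup `H ⊆ ℤ^r`; in
particular `E` belongs to the class `𝒞`. -/
theorem one_dimensional_subgroup_case (F V : Type*) [Field F] [CharZero F]
    [AddCommGroup V] [Module F V] (r : ℕ) (J : Fin r → (V ≃ₗ[F] V))
    (hcomm : ∀ i j, Commute (J i) (J j)) (u₀ : V) (L : Submodule F V)
    (hL : Module.finrank F L = 1) :
    ({n : Fin r → ℕ | (List.ofFn fun i => J i ^ n i).prod u₀ ∈ L} = ∅ ∨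
      ∃ (γ : Fin r → ℤ) (H : AddSubgroup (Fin r → ℤ)),
        {n : Fin r → ℕ | (List.ofFn fun i => J i ^ n i).prod u₀ ∈ L}
          = {n : Fin r → ℕ | (fun i => (n i : ℤ)) - γ ∈ H}) ∧
    inC {n : Fin r → ℕ | (List.ofFn fun i => J i ^ n i).prod u₀ ∈ L} := by
  obtain ⟨φ, hφ⟩ := exists_hom_eq_prod_pow_of_commute J hcomm
  rcases Set.eq_empty_or_nonempty
    {n : Fin r → ℕ | (List.ofFn fun i => J i ^ n i).prod u₀ ∈ L} with hE | ⟨m, hm⟩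
  · exact ⟨Or.inl hE, hE ▸ ⟨0, Fin.elim0, Fin.elim0, by simp⟩⟩
  · rw [Set.mem_ofPred_eq, ← hφ] at hm
    have hE : {n : Fin r → ℕ | (List.ofFn fun i => J i ^ n i).prod u₀ ∈ L} =
        {n | (fun i => (n i : ℤ)) - (fun i => (m i : ℤ)) ∈ eigenSubgroup φ _} :=
      Set.ext fun n => by
        rw [Set.mem_ofPred_eq, ← hφ]
        exact apply_mem_iff_sub_mem_eigenSubgroup φ hL hm _
    exact ⟨Or.inr ⟨_, _, hE⟩, hE ▸ inC_setOf_sub_mem _ _⟩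
end

section
/- The set of pairs (m, n) ∈ ℕ² satisfying (2n − m)² = 3m is exactly {(3k², 3(k² + k)/2) : k ∈ ℕ} ∪ {(3k², 3(k² − k)/2) : k ∈ ℕ}, and this set does not belong to the class 𝒞. -/
/-- A parabola point `(m, n)` is `(3j², 3(j² + j)/2)` for some integer `j`. -/
theorem exists_param_of_sq_eq {m n : ℤ} (h : (2 * n - m) ^ 2 = 3 * m) :
    ∃ j : ℤ, m = 3 * j ^ 2 ∧ 2 * n = 3 * (j ^ 2 + j) := by
  obtain ⟨j, hj⟩ : (3 : ℤ) ∣ 2 * n - m := Int.prime_three.dvd_of_dvd_pow ⟨m, h⟩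
  rw [hj] at h
  exact ⟨j, by linarith, by linarith⟩

/-- The parabola `(2n − m)² = 3m` contains no three equally spaced points `p, p + s, p + 2s`
with `s ≠ 0`. -/
theorem step_eq_zero_of_sq_eq {a b u v : ℤ} (h₀ : (2 * b - a) ^ 2 = 3 * a)
    (h₁ : (2 * (b + v) - (a + u)) ^ 2 = 3 * (a + u))
    (h₂ : (2 * (b + 2 * v) - (a + 2 * u)) ^ 2 = 3 * (a + 2 * u)) : u = 0 ∧ v = 0 := by
  have hd : 2 * v - u = 0 := pow_eq_zero_iff two_ne_zero |>.mp (by linarith : (2 * v - u) ^ 2 = 0)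
  obtain rfl : u = 2 * v := by linarith
  constructor <;> linarith

theorem finite_of_inC {r : ℕ} {E : Set (Fin r → ℕ)} (hE : inC E)
    (h : ∀ p s : Fin r → ℕ, p ∈ E → p + s ∈ E → p + 2 • s ∈ E → s = 0) : E.Finite := by
  obtain ⟨ℓ, γ, H, hU⟩ := hE
  have mem : ∀ i, ∀ s ∈ natPart (H i), γ i + s ∈ E := fun i s hs => by
    rw [hU]
    exact Set.mem_iUnion.mpr ⟨i, s, hs, rfl⟩
  refine (Set.finite_range γ).subset fun p hp => ?_
  rw [hU] at hp
  obtain ⟨i, s, hs, rfl⟩ := Set.mem_iUnion.mp hp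
  have h0 : (0 : Fin r → ℕ) ∈ natPart (H i) := (H i).zero_mem
  have h2 : 2 • s ∈ natPart (H i) := by
    convert (H i).nsmul_mem hs 2 using 1
    simp [natPart, Pi.smul_def]
  have hs0 : s = 0 := h (γ i) s (by simpa using mem i 0 h0) (mem i s hs) (mem i _ h2)
  exact ⟨i, by simp [hs0]⟩

/-- The set of pairs `(m, n) ∈ ℕ²` with `(2n − m)² = 3m` is exactly
`{(3k², 3(k²+k)/2) : k ∈ ℕ} ∪ {(3k², 3(k²−k)/2) : k ∈ ℕ}`, and it does not
belong to the class `𝒞`. -/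
theorem counterexample_line :
    ({p : Fin 2 → ℕ | (2 * (p 1 : ℤ) - (p 0 : ℤ)) ^ 2 = 3 * (p 0 : ℤ)}
      = {p : Fin 2 → ℕ | ∃ k : ℕ,
            p 0 = 3 * k ^ 2 ∧ 2 * p 1 = 3 * (k ^ 2 + k)} ∪
        {p : Fin 2 → ℕ | ∃ k : ℕ,
            p 0 = 3 * k ^ 2 ∧ 2 * p 1 + 3 * k = 3 * k ^ 2}) ∧
    ¬ inC {p : Fin 2 → ℕ |
        (2 * (p 1 : ℤ) - (p 0 : ℤ)) ^ 2 = 3 * (p 0 : ℤ)} := by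
  refine ⟨?_, fun hC => ?_⟩
  · ext p
    simp only [Set.mem_ofPred_eq, Set.mem_union]
    constructor
    · intro h
      obtain ⟨j, hm, hn⟩ := exists_param_of_sq_eq h
      obtain ⟨k, rfl | rfl⟩ := j.eq_nat_or_neg
      · exact Or.inl ⟨k, by exact_mod_cast hm, by exact_mod_cast hn⟩
      · refine Or.inr ⟨k, ?_, ?_⟩ <;> zify <;> linarith
    · rintro (⟨k, hm, hn⟩ | ⟨k, hm, hn⟩) <;> zify at hm hn
      · rw [hn, hm]
        ring
      · rw [eq_sub_of_add_eq hn, hm]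
        ring
  · refine Set.infinite_of_injective_forall_mem
      (f := fun k : ℕ => (![12 * k ^ 2, 6 * k ^ 2 + 3 * k] : Fin 2 → ℕ)) ?_ ?_
      (finite_of_inC hC ?_)
    · intro k l hkl
      have h0 : 12 * k ^ 2 = 12 * l ^ 2 := congrFun hkl 0
      have h1 : 6 * k ^ 2 + 3 * k = 6 * l ^ 2 + 3 * l := congrFun hkl 1
      omega
    · intro k
      simp only [Set.mem_ofPred_eq, Matrix.cons_val_zero, Matrix.cons_val_one]
      push_cast
      ring
    · intro p s h₀ h₁ h₂
      simp only [Set.mem_ofPred_eq, Pi.add_apply, Pi.smul_apply, smul_eq_mul, Nat.cast_add,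
        Nat.cast_mul, Nat.cast_ofNat] at h₀ h₁ h₂
      obtain ⟨hu, hv⟩ := step_eq_zero_of_sq_eq h₀ h₁ h₂
      ext i
      fin_cases i
      · exact_mod_cast hu
      · exact_mod_cast hv
end

section
/- The set of pairs (m, n) ∈ ℕ² satisfying (2n − m)² = 6n is exactly {(12k² + 6k, 6k²) : k ∈ ℕ} ∪ {(12k² − 6k, 6k²) : k ∈ ℕ}, and this set does not belong to the class 𝒞. -/
theorem quadratic_sq_eq_linear {a b c d : ℤ} (h0 : a ^ 2 = 6 * c)
    (h1 : (a + b) ^ 2 = 6 * (c + d)) (h2 : (a + 2 * b) ^ 2 = 6 * (c + 2 * d)) :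
    b = 0 ∧ d = 0 := by
  have hb : b = 0 := by
    have : b ^ 2 = 0 := by linarith
    exact pow_eq_zero_iff two_ne_zero |>.mp this
  subst hb
  exact ⟨rfl, by linarith⟩

theorem nsmul_mem_natPart {r : ℕ} {H : AddSubgroup (Fin r → ℤ)} {s : Fin r → ℕ}
    (hs : s ∈ natPart H) (t : ℕ) : t • s ∈ natPart H := by
  have h := H.nsmul_mem hs t
  have e : (fun i => (((t • s) i : ℕ) : ℤ)) = t • (fun i => (s i : ℤ)) := by
    funext i
    simp
  change (fun i => (((t • s) i : ℕ) : ℤ)) ∈ H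
  rwa [e]

theorem parabola_eq_union :
    {p : Fin 2 → ℕ | (2 * (p 1 : ℤ) - (p 0 : ℤ)) ^ 2 = 6 * (p 1 : ℤ)}
      = {p : Fin 2 → ℕ | ∃ k : ℕ,
            p 1 = 6 * k ^ 2 ∧ p 0 = 12 * k ^ 2 + 6 * k} ∪
        {p : Fin 2 → ℕ | ∃ k : ℕ,
            p 1 = 6 * k ^ 2 ∧ p 0 + 6 * k = 12 * k ^ 2} := by
  ext p
  simp only [Set.mem_ofPred_eq, Set.mem_union]
  generalize p 0 = m
  generalize p 1 = n
  constructor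
  · intro h
    have h2 : (2 : ℤ) ∣ 2 * n - m :=
      Int.prime_two.dvd_of_dvd_pow (n := 2) ⟨3 * n, by rw [h]; ring⟩
    have h3 : (3 : ℤ) ∣ 2 * n - m :=
      Int.prime_three.dvd_of_dvd_pow (n := 2) ⟨2 * n, by rw [h]; ring⟩
    obtain ⟨j, hj⟩ : (6 : ℤ) ∣ 2 * n - m := by omega
    have hn : (n : ℤ) = 6 * j ^ 2 := by
      rw [hj] at h
      linarith
    rcases Int.eq_nat_or_neg j with ⟨k, rfl | rfl⟩
    · right
      refine ⟨k, ?_, ?_⟩ <;> zify <;> linarith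
    · left
      rw [neg_sq] at hn
      refine ⟨k, ?_, ?_⟩ <;> zify <;> linarith
  · rintro (⟨k, rfl, rfl⟩ | ⟨k, rfl, h⟩)
    · push_cast
      ring
    · zify at h
      have hm : (m : ℤ) = 12 * k ^ 2 - 6 * k := by linarith
      rw [hm]
      push_cast
      ring

theorem parabola_infinite :
    {p : Fin 2 → ℕ | (2 * (p 1 : ℤ) - (p 0 : ℤ)) ^ 2 = 6 * (p 1 : ℤ)}.Infinite := by
  refine Set.infinite_of_injective_forall_mem
    (f := fun k : ℕ => ![12 * k ^ 2 + 6 * k, 6 * k ^ 2]) ?_ ?_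
  · intro k l h
    have h1 : 6 * k ^ 2 = 6 * l ^ 2 := congrFun h 1
    exact Nat.pow_left_injective two_ne_zero (by simpa using h1)
  · intro k
    rw [parabola_eq_union]
    exact Or.inl ⟨k, rfl, rfl⟩

theorem not_inC_parabola :
    ¬ inC {p : Fin 2 → ℕ |
        (2 * (p 1 : ℤ) - (p 0 : ℤ)) ^ 2 = 6 * (p 1 : ℤ)} := by
  rintro ⟨ℓ, γ, H, hE⟩
  refine parabola_infinite ((Set.finite_range γ).subset fun p hp => ?_)
  rw [hE] at hp
  obtain ⟨i, s, hs, rfl⟩ := Set.mem_iUnion.mp hp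
  have key (t : ℕ) : (2 * ((γ i + t • s) 1 : ℕ) - ((γ i + t • s) 0 : ℕ) : ℤ) ^ 2
      = 6 * ((γ i + t • s) 1 : ℕ) := by
    have : γ i + t • s ∈ ⋃ i, (fun s => γ i + s) '' natPart (H i) :=
      Set.mem_iUnion.mpr ⟨i, t • s, nsmul_mem_natPart hs t, rfl⟩
    rwa [← hE] at this
  have h0 := key 0
  have h1 := key 1
  have h2 := key 2
  simp only [Pi.add_apply, Pi.smul_apply, smul_eq_mul] at h0 h1 h2
  push_cast at h0 h1 h2
  obtain ⟨hb, hd⟩ := quadratic_sq_eq_linear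
    (a := 2 * (γ i 1 : ℤ) - γ i 0) (b := 2 * (s 1 : ℤ) - s 0) (c := γ i 1) (d := s 1)
    (by linarith) (by linarith) (by linarith)
  have hs0 : s = 0 := by
    funext j
    fin_cases j
    · change s 0 = 0
      omega
    · change s 1 = 0
      omega
  exact ⟨i, by simp [hs0]⟩

/-- The set of pairs `(m, n) ∈ ℕ²` with `(2n − m)² = 6n` is exactly
`{(12k² + 6k, 6k²) : k ∈ ℕ} ∪ {(12k² − 6k, 6k²) : k ∈ ℕ}`, and it does not
belong to the class `𝒞`. -/
theorem counterexample_nonautomorphisms :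
    ({p : Fin 2 → ℕ | (2 * (p 1 : ℤ) - (p 0 : ℤ)) ^ 2 = 6 * (p 1 : ℤ)}
      = {p : Fin 2 → ℕ | ∃ k : ℕ,
            p 1 = 6 * k ^ 2 ∧ p 0 = 12 * k ^ 2 + 6 * k} ∪
        {p : Fin 2 → ℕ | ∃ k : ℕ,
            p 1 = 6 * k ^ 2 ∧ p 0 + 6 * k = 12 * k ^ 2}) ∧
    ¬ inC {p : Fin 2 → ℕ |
        (2 * (p 1 : ℤ) - (p 0 : ℤ)) ^ 2 = 6 * (p 1 : ℤ)} := by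
  exact ⟨parabola_eq_union, not_inC_parabola⟩
end
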